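/- arXiv:1610.03310 — 5 statements merged into one kernel-verified Lean document; each statement's English description precedes it below -/
import Mathlib

section
/- Let V, A : ℝ⁴ → ℝ⁴ be differentiable covector fields with Σ_{μ,ν} η^{μν} V_μ(x) V_ν(x) = 1 for all x, let m, e ∈ ℝ, set F_{μν} = ∂_μ A_ν − ∂_ν A_μ, and let σ : ℝ → ℝ⁴ be differentiable with (σ'(s))^μ = Σ_ν η^{μν} V_ν(σ(s)). Then the Lorentz force law m · d/ds[V_ν(σ(s))] = e · Σ_{μ,α} η^{μα} V_α(σ(s)) F_{μν}(σ(s)) holds for all s and ν if and only if Σ_{μ,α} η^{μα} V_α(σ(s)) · [∂_μ(m V_ν − e A_ν) − ∂_ν(m V_μ − e A_μ)](σ(s)) = 0 for all s and ν. -/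
noncomputable section

/-- The Minkowski metric matrix `η^{μν} = η_{μν} = diag(1,-1,-1,-1)`. -/
def ηm (μ ν : Fin 4) : ℝ := if μ = ν then (if μ = 0 then 1 else -1) else 0

/-- The partial derivative `∂_μ f` of a function `f : ℝ⁴ → ℝ` at `x`. -/
def pd (μ : Fin 4) (f : (Fin 4 → ℝ) → ℝ) (x : Fin 4 → ℝ) : ℝ :=
  deriv (fun t : ℝ => f (x + t • (Pi.single μ 1 : Fin 4 → ℝ))) 0

lemma pd_eq_fderiv {f : (Fin 4 → ℝ) → ℝ} {x : Fin 4 → ℝ} (hf : DifferentiableAt ℝ f x)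
    (μ : Fin 4) : pd μ f x = fderiv ℝ f x (Pi.single μ 1) :=
  hf.lineDeriv_eq_fderiv

/-- The chain rule along a curve, in coordinates. -/
lemma deriv_comp_eq_sum_pd {f : (Fin 4 → ℝ) → ℝ} {σ : ℝ → Fin 4 → ℝ} {s : ℝ}
    (hf : DifferentiableAt ℝ f (σ s)) (hσ : DifferentiableAt ℝ σ s) :
    deriv (fun t => f (σ t)) s = ∑ μ, deriv σ s μ * pd μ f (σ s) := by
  have h : deriv (fun t => f (σ t)) s = fderiv ℝ f (σ s) (deriv σ s) :=
    (hf.hasFDerivAt.comp_hasDerivAt s hσ.hasDerivAt).deriv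
  rw [h]
  conv_lhs => rw [pi_eq_sum_univ' (deriv σ s)]
  simp only [map_sum, map_smul, smul_eq_mul, pd_eq_fderiv hf]

lemma pd_const_mul_sub_const_mul {f g : (Fin 4 → ℝ) → ℝ} {x : Fin 4 → ℝ}
    (hf : DifferentiableAt ℝ f x) (hg : DifferentiableAt ℝ g x) (a b : ℝ) (μ : Fin 4) :
    pd μ (fun y => a * f y - b * g y) x = a * pd μ f x - b * pd μ g x := by
  have h : HasFDerivAt (fun y => a * f y - b * g y) (a • fderiv ℝ f x - b • fderiv ℝ g x) x :=
    (hf.hasFDerivAt.const_mul a).sub (hg.hasFDerivAt.const_mul b)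
  rw [pd_eq_fderiv h.differentiableAt, h.fderiv, pd_eq_fderiv hf, pd_eq_fderiv hg]
  simp

/-- A covector field of constant Minkowski square is orthogonal to each of its partial
derivatives. -/
lemma sum_mul_pd_eq_zero_of_sum_mul_eq_const {V : (Fin 4 → ℝ) → Fin 4 → ℝ} {c : ℝ}
    (hV : ∀ ν, Differentiable ℝ fun x => V x ν)
    (hc : ∀ x, ∑ μ, ∑ ν, ηm μ ν * V x μ * V x ν = c) (x : Fin 4 → ℝ) (ν : Fin 4) :
    ∑ μ, ∑ α, ηm μ α * V x α * pd ν (fun y => V y μ) x = 0 := by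
  have hd (μ : Fin 4) := (hV μ x).hasFDerivAt
  have h : HasFDerivAt (fun x => ∑ μ, ∑ ν, ηm μ ν * V x μ * V x ν) _ x :=
    HasFDerivAt.fun_sum fun μ _ => HasFDerivAt.fun_sum fun α _ =>
      ((hd μ).const_mul (ηm μ α)).mul (hd α)
  have h0 := h.unique ((hasFDerivAt_const c x).congr_of_eventuallyEq (.of_forall hc))
  have h1 := DFunLike.congr_fun h0 (Pi.single ν 1)
  simp only [pd_eq_fderiv (hV _ x)]
  simp [Fin.sum_univ_four, ηm] at h1 ⊢
  linarith

/-- The Lorentz force law `m v̇ = e v⌟F` along an integral curve `σ` of (the vector field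
associated with) the unit covector field `V` holds iff `V⌟[d(mV - eA)] = 0` along `σ`. -/
theorem statement1
    (V A : (Fin 4 → ℝ) → Fin 4 → ℝ)
    (hVdiff : ∀ ν, Differentiable ℝ fun x => V x ν)
    (hAdiff : ∀ ν, Differentiable ℝ fun x => A x ν)
    (hVunit : ∀ x, ∑ μ, ∑ ν, ηm μ ν * V x μ * V x ν = 1)
    (m e : ℝ)
    (F : (Fin 4 → ℝ) → Fin 4 → Fin 4 → ℝ)
    (hF : ∀ x μ ν, F x μ ν = pd μ (fun y => A y ν) x - pd ν (fun y => A y μ) x)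
    (σ : ℝ → Fin 4 → ℝ)
    (hσdiff : Differentiable ℝ σ)
    (hint : ∀ s μ, deriv σ s μ = ∑ ν, ηm μ ν * V (σ s) ν) :
    (∀ s ν, m * deriv (fun s => V (σ s) ν) s
        = e * ∑ μ, ∑ α, ηm μ α * V (σ s) α * F (σ s) μ ν)
    ↔ (∀ s ν, ∑ μ, ∑ α, ηm μ α * V (σ s) α *
          (pd μ (fun y => m * V y ν - e * A y ν) (σ s)
            - pd ν (fun y => m * V y μ - e * A y μ) (σ s)) = 0) := by
  have key (s : ℝ) (ν : Fin 4) : ∑ μ, ∑ α, ηm μ α * V (σ s) α *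
      (pd μ (fun y => m * V y ν - e * A y ν) (σ s)
        - pd ν (fun y => m * V y μ - e * A y μ) (σ s))
      = m * deriv (fun s => V (σ s) ν) s
        - e * ∑ μ, ∑ α, ηm μ α * V (σ s) α * F (σ s) μ ν := by
    have hunit := sum_mul_pd_eq_zero_of_sum_mul_eq_const hVdiff hVunit (σ s) ν
    rw [deriv_comp_eq_sum_pd (hVdiff ν (σ s)) (hσdiff s)]
    simp only [hint, hF, pd_const_mul_sub_const_mul (hVdiff _ (σ s)) (hAdiff _ (σ s)),
      Finset.sum_mul]
    rw [← sub_zero (m * _), ← mul_zero m, ← hunit]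
    simp only [Finset.mul_sum, ← Finset.sum_sub_distrib]
    refine Finset.sum_congr rfl fun μ _ => Finset.sum_congr rfl fun α _ => ?_
    ring
  simp only [key, sub_eq_zero]
end
end

section
/- Let ψ₀ ∈ ℝ_{1,3} be a fixed element, let S : ℝ⁴ → ℝ be differentiable, and define ψ : ℝ⁴ → ℝ_{1,3} by ψ(x) = ψ₀ · e^{S(x)γ21} = ψ₀ · (cos S(x) + sin S(x) · γ21). Then for every x ∈ ℝ⁴: Σ_μ γ^μ · (∂_μ ψ)(x) · γ21 = −(Σ_μ γ^μ ∂_μ S(x)) · ψ(x); that is, ∂ψ γ21 = −(∂S)ψ. -/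
noncomputable section
open CliffordAlgebra

/-- The Minkowski quadratic form `Q(x) = x₀² - x₁² - x₂² - x₃²` on `ℝ⁴`. -/
def Qmink : QuadraticForm ℝ (Fin 4 → ℝ) :=
  QuadraticMap.weightedSumSquares ℝ ![(1 : ℝ), -1, -1, -1]

/-- The spacetime algebra `ℝ_{1,3}`. -/
abbrev STA : Type := CliffordAlgebra Qmink

/-- The generating vectors `γ_μ = ι(e_μ)`. -/
def γ (μ : Fin 4) : STA := ι Qmink (Pi.single μ 1)

/-- The signs `η^{μμ} = diag(1,-1,-1,-1)`. -/
def ηsgn (μ : Fin 4) : ℝ := if μ = 0 then 1 else -1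

/-- The raised-index vectors `γ^μ := η^{μμ} γ_μ`. -/
def γup (μ : Fin 4) : STA := ηsgn μ • γ μ

/-- The bivector `γ21 := γ₂γ₁` (it squares to `-1`). -/
def γ21 : STA := γ 2 * γ 1

/-- `e^{θ γ21} := cos θ + (sin θ) γ21`. -/
def expG21 (θ : ℝ) : STA := algebraMap ℝ STA (Real.cos θ) + Real.sin θ • γ21

/-- `f' ` is the `μ`-th partial derivative of the spacetime-algebra valued field `f`
(tested against all real-linear functionals, since `STA` carries no topology). -/
def HasPDeriv (μ : Fin 4) (f f' : (Fin 4 → ℝ) → STA) : Prop :=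
  ∀ (L : STA →ₗ[ℝ] ℝ) (x : Fin 4 → ℝ),
    HasDerivAt (fun t : ℝ => L (f (x + t • (Pi.single μ 1 : Fin 4 → ℝ)))) (L (f' x)) 0

theorem γ_mul_self (μ : Fin 4) :
    γ μ * γ μ = algebraMap ℝ STA (![(1 : ℝ), -1, -1, -1] μ) := by
  rw [γ, ι_sq_scalar]
  congr 1
  simp [Qmink, QuadraticMap.weightedSumSquares_apply, Pi.single_apply]

theorem γ_one_mul_γ_two : γ 1 * γ 2 = -(γ 2 * γ 1) := by
  have h : QuadraticMap.polar Qmink (Pi.single 1 1) (Pi.single 2 1) = 0 := by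
    simp [QuadraticMap.polar, Qmink, QuadraticMap.weightedSumSquares_apply, Fin.sum_univ_four,
      Pi.single_apply]
  rw [eq_neg_iff_add_eq_zero, γ, γ, ι_mul_ι_add_swap, h, map_zero]

theorem γ21_mul_self : γ21 * γ21 = -1 := by
  calc γ21 * γ21 = γ 2 * (γ 1 * γ 2) * γ 1 := by simp only [γ21, mul_assoc]
    _ = -(γ 2 * γ 2 * (γ 1 * γ 1)) := by
      rw [γ_one_mul_γ_two]
      simp only [mul_neg, neg_mul, mul_assoc]
    _ = -1 := by simp [γ_mul_self]

theorem expG21_mul_γ21 (θ : ℝ) :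
    expG21 θ * γ21 = -(Real.sin θ • (1 : STA)) + Real.cos θ • γ21 := by
  rw [expG21, add_mul, smul_mul_assoc, γ21_mul_self, Algebra.algebraMap_eq_smul_one,
    smul_mul_assoc, one_mul, smul_neg, add_comm]

theorem hasDerivAt_lineSection {S : (Fin 4 → ℝ) → ℝ} (hS : Differentiable ℝ S) (μ : Fin 4)
    (x : Fin 4 → ℝ) :
    HasDerivAt (fun t : ℝ => S (x + t • (Pi.single μ 1 : Fin 4 → ℝ))) (pd μ S x) 0 := by
  refine DifferentiableAt.hasDerivAt ?_
  fun_prop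

/-- The partial derivatives of `ψ₀ e^{S γ21}` along a linear functional. -/
theorem hasDerivAt_apply_mul_expG21 (ψ₀ : STA) {S : (Fin 4 → ℝ) → ℝ} (hS : Differentiable ℝ S)
    (L : STA →ₗ[ℝ] ℝ) (μ : Fin 4) (x : Fin 4 → ℝ) :
    HasDerivAt (fun t : ℝ => L (ψ₀ * expG21 (S (x + t • (Pi.single μ 1 : Fin 4 → ℝ)))))
      (L (pd μ S x • (ψ₀ * expG21 (S x) * γ21))) 0 := by
  have h := hasDerivAt_lineSection hS μ x
  have key := (h.cos.mul_const (L ψ₀)).add (h.sin.mul_const (L (ψ₀ * γ21)))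
  refine (key.congr_deriv ?_).congr_of_eventuallyEq (.of_forall fun t => ?_)
  · rw [mul_assoc ψ₀, expG21_mul_γ21]
    simp only [mul_add, mul_neg, mul_smul_comm, mul_one, map_smul, map_add, map_neg, smul_eq_mul,
      zero_smul, add_zero]
    ring
  · simp [expG21, mul_add, Algebra.algebraMap_eq_smul_one]

/-- For `ψ(x) = ψ₀ e^{S(x)γ21}` with `ψ₀` constant: `∂ψ γ21 = -(∂S) ψ`. -/
theorem statement3 (ψ₀ : STA) (S : (Fin 4 → ℝ) → ℝ) (hS : Differentiable ℝ S)
    (ψ : (Fin 4 → ℝ) → STA) (hψ : ψ = fun x => ψ₀ * expG21 (S x))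
    (ψ' : Fin 4 → (Fin 4 → ℝ) → STA) (hψ' : ∀ μ, HasPDeriv μ ψ (ψ' μ))
    (x : Fin 4 → ℝ) :
    ∑ μ, γup μ * ψ' μ x * γ21 = -((∑ μ, pd μ S x • γup μ) * ψ x) := by
  subst hψ
  have hd : ∀ μ, ψ' μ x = pd μ S x • (ψ₀ * expG21 (S x) * γ21) := fun μ => by
    rw [← sub_eq_zero, ← Module.forall_dual_apply_eq_zero_iff ℝ]
    intro L
    rw [map_sub, sub_eq_zero]
    exact (hψ' μ L x).unique (hasDerivAt_apply_mul_expG21 ψ₀ hS L μ x)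
  rw [Finset.sum_mul, ← Finset.sum_neg_distrib]
  refine Finset.sum_congr rfl fun μ _ => ?_
  rw [hd, mul_assoc, smul_mul_assoc, mul_assoc (ψ₀ * _), γ21_mul_self, mul_neg_one, smul_neg,
    mul_neg, mul_smul_comm, smul_mul_assoc]
end
end

section
/- Let m > 0 and let P = Σ_μ P_μ γ^μ ∈ ℝ_{1,3} be a 1-vector whose components P_μ ∈ ℝ satisfy Σ_{μ,ν} η^{μν} P_μ P_ν = m² and m + P₀ > 0. Define R := (m + Pγ⁰) / √(2m(m + P₀)). Then R is a rotor, i.e. R R̃ = 1, and R γ⁰ R̃ = P / m; in particular R γ⁰ R⁻¹ = P/m. -/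
noncomputable section
open CliffordAlgebra

theorem algebra_rotor_mul_conj {A : Type*} [Ring A] [Algebra ℝ A] (m p : ℝ) (P g : A)
    (hg : g * g = 1) (hP : P * P = algebraMap ℝ A (m ^ 2))
    (hPg : P * g + g * P = algebraMap ℝ A (2 * p)) :
    (algebraMap ℝ A m + P * g) * (algebraMap ℝ A m + g * P) =
        algebraMap ℝ A (2 * m * (m + p)) ∧
      (algebraMap ℝ A m + P * g) * g * (algebraMap ℝ A m + g * P) = (2 * (m + p)) • P := by
  have hgP : g * P = algebraMap ℝ A (2 * p) - P * g := eq_sub_of_add_eq' hPg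
  have hPggP : P * g * (g * P) = algebraMap ℝ A (m ^ 2) := by
    rw [mul_assoc, ← mul_assoc g, hg, one_mul, hP]
  have hPgP : P * (g * P) = (2 * p) • P - m ^ 2 • g := by
    rw [hgP, mul_sub, ← mul_assoc, hP, ← Algebra.commutes, Algebra.smul_def, Algebra.smul_def]
  have hggP : g * (g * P) = P := by rw [← mul_assoc, hg, one_mul]
  simp only [Algebra.algebraMap_eq_smul_one] at *
  constructor
  · calc _ = (m * m) • (1 : A) + m • (P * g + g * P) + P * g * (g * P) := by
          simp only [add_mul, mul_add, smul_mul_assoc, mul_smul_comm, one_mul, mul_one]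
          module
      _ = _ := by
          rw [hPg, hPggP]
          module
  · rw [add_mul, mul_assoc P, hg, mul_one]
    simp only [add_mul, mul_add, smul_mul_assoc, mul_smul_comm, one_mul, mul_one, hggP, hPgP]
    module

theorem γ_zero_mul_self : γ 0 * γ 0 = 1 := by
  have hQ : Qmink (Pi.single 0 1) = 1 := by
    simp [Qmink, QuadraticMap.weightedSumSquares_apply, Fin.sum_univ_four]
  rw [γ, ι_sq_scalar, hQ, map_one]

theorem sum_smul_γup (p : Fin 4 → ℝ) :
    ∑ μ, p μ • γup μ = ι Qmink (fun μ => p μ * ηsgn μ) := by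
  simp only [γup, γ, ← map_smul, ← map_sum]
  congr 1
  ext μ
  simp [Finset.sum_apply, Pi.single_apply]

theorem ι_mul_γ_zero_add_swap (v : Fin 4 → ℝ) :
    ι Qmink v * γ 0 + γ 0 * ι Qmink v = algebraMap ℝ STA (2 * v 0) := by
  rw [γ, ι_mul_ι_add_swap]
  congr 1
  simp [QuadraticMap.polar, Qmink, QuadraticMap.weightedSumSquares_apply, Fin.sum_univ_four]
  ring

/-- If `P = Σ P_μ γ^μ` with `P² = m²` (i.e. `Σ η^{μν}P_μ P_ν = m²`) and `m + P₀ > 0`, then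
`R := (m + Pγ⁰)/√(2m(m + P₀))` is a rotor and `R γ⁰ R̃ = P/m`. -/
theorem statement6 (m : ℝ) (hm : 0 < m) (Pc : Fin 4 → ℝ)
    (hP2 : ∑ μ, ∑ ν, ηm μ ν * Pc μ * Pc ν = m ^ 2)
    (hpos : 0 < m + Pc 0)
    (P : STA) (hP : P = ∑ μ, Pc μ • γup μ)
    (R : STA)
    (hR : R = (Real.sqrt (2 * m * (m + Pc 0)))⁻¹ • (algebraMap ℝ STA m + P * γ 0)) :
    R ∈ evenOdd Qmink 0 ∧ R * reverse R = 1 ∧ R * γ 0 * reverse R = m⁻¹ • P := by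
  rw [sum_smul_γup] at hP
  have hPP : P * P = algebraMap ℝ STA (m ^ 2) := by
    rw [hP, ι_sq_scalar, ← hP2]
    congr 1
    simp [Qmink, QuadraticMap.weightedSumSquares_apply, Fin.sum_univ_four, ηm, ηsgn]
  have hPg : P * γ 0 + γ 0 * P = algebraMap ℝ STA (2 * Pc 0) := by
    rw [hP, ι_mul_γ_zero_add_swap]
    simp [ηsgn]
  obtain ⟨hone, hconj⟩ := algebra_rotor_mul_conj m (Pc 0) P (γ 0) γ_zero_mul_self hPP hPg
  have hrev : reverse R =
      (Real.sqrt (2 * m * (m + Pc 0)))⁻¹ • (algebraMap ℝ STA m + γ 0 * P) := by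
    rw [hR, hP, γ]
    simp [reverse.map_mul]
  have hnorm : 0 < 2 * m * (m + Pc 0) := by positivity
  have hsq : (Real.sqrt (2 * m * (m + Pc 0)))⁻¹ * (Real.sqrt (2 * m * (m + Pc 0)))⁻¹ =
      (2 * m * (m + Pc 0))⁻¹ := by
    rw [← mul_inv, Real.mul_self_sqrt hnorm.le]
  refine ⟨?_, ?_, ?_⟩
  · rw [hR, hP, γ]
    refine Submodule.smul_mem _ _ (Submodule.add_mem _ ?_ (ι_mul_ι_mem_evenOdd_zero _ _ _))
    exact SetLike.algebraMap_mem_graded (evenOdd Qmink) m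
  · rw [hrev, hR, smul_mul_smul_comm, hone, hsq, Algebra.algebraMap_eq_smul_one, smul_smul,
      inv_mul_cancel₀ hnorm.ne', one_smul]
  · rw [hrev, hR, smul_mul_assoc, smul_mul_smul_comm, hconj, hsq, smul_smul]
    congr 1
    field_simp
end
end

section
/- (Realization of de Broglie's double solution.) Let m ∈ ℝ, let ϝ₀ : ℝ⁴ → ℝ_{1,3} and S : ℝ⁴ → ℝ be differentiable, and define ϝ(x) = ϝ₀(x) · e^{S(x)γ21}. Assume: (i) ϝ satisfies the free Dirac–Hestenes equation, Σ_μ γ^μ (∂_μ ϝ)(x) γ21 − m ϝ(x) γ⁰ = 0 for all x; and (ii) −(Σ_μ γ^μ ∂_μ S(x)) · ϝ₀(x) = m ϝ₀(x) γ⁰ for all x (i.e. −∂S = m ϝ₀ γ⁰ ϝ₀⁻¹ whenever ϝ₀ is invertible). Then ϝ₀ satisfies the massless Dirac–Hestenes equation: Σ_μ γ^μ (∂_μ ϝ₀)(x) = 0 for all x. -/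
noncomputable section
open CliffordAlgebra

theorem γ_mul_γ_swap {i j : Fin 4} (h : i ≠ j) : γ i * γ j = -(γ j * γ i) := by
  rw [eq_neg_iff_add_eq_zero, γ, γ, ι_mul_ι_add_swap]
  have : QuadraticMap.polar Qmink (Pi.single i 1) (Pi.single j 1) = 0 := by
    fin_cases i <;> fin_cases j <;>
      simp_all [QuadraticMap.polar, Qmink, QuadraticMap.weightedSumSquares_apply,
        Fin.sum_univ_four, Pi.single_apply]
  rw [this, map_zero]

theorem γ_sq_spacelike {i : Fin 4} (h : i ≠ 0) : γ i * γ i = -1 := by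
  have : Qmink (Pi.single i 1) = -1 := by
    fin_cases i <;>
      simp_all [Qmink, QuadraticMap.weightedSumSquares_apply, Pi.single_apply]
  rw [γ, ι_sq_scalar, this, map_neg, map_one]

theorem commute_γ21_γ_zero : Commute γ21 (γ 0) := by
  calc γ21 * γ 0 = γ 2 * (γ 1 * γ 0) := by rw [γ21, mul_assoc]
    _ = -((γ 2 * γ 0) * γ 1) := by
      rw [γ_mul_γ_swap (by decide : (1 : Fin 4) ≠ 0)]
      simp only [mul_neg, mul_assoc]
    _ = γ 0 * γ21 := by
      rw [γ_mul_γ_swap (by decide : (2 : Fin 4) ≠ 0)]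
      simp only [neg_mul, neg_neg, mul_assoc, γ21]

theorem Commute.expG21_left {a : STA} (h : Commute γ21 a) (θ : ℝ) : Commute (expG21 θ) a :=
  (Algebra.commute_algebraMap_left _ _).add_left (h.smul_left _)

theorem expG21_mul_expG21_neg (θ : ℝ) : expG21 θ * expG21 (-θ) = 1 := by
  simp only [expG21, Algebra.algebraMap_eq_smul_one, Real.cos_neg, Real.sin_neg, add_mul, mul_add,
    smul_mul_smul_comm, one_mul, mul_one, γ21_mul_self]
  have h := congrArg (fun r : ℝ => r • (1 : STA)) (Real.sin_sq_add_cos_sq θ)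
  rw [one_smul] at h
  linear_combination (norm := module) h

/-- The Leibniz rule for a spinor field times a phase factor. -/
theorem HasPDeriv.mul_expG21 {μ : Fin 4} {f f' : (Fin 4 → ℝ) → STA} (hf : HasPDeriv μ f f')
    {S : (Fin 4 → ℝ) → ℝ} (hS : Differentiable ℝ S) :
    HasPDeriv μ (fun x => f x * expG21 (S x))
      (fun x => f' x * expG21 (S x) + pd μ S x • (f x * (γ21 * expG21 (S x)))) := by
  intro L x
  have hSx : HasDerivAt (fun t : ℝ => S (x + t • (Pi.single μ 1 : Fin 4 → ℝ))) (pd μ S x) 0 :=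
    DifferentiableAt.hasDerivAt (by fun_prop)
  have h := (hSx.cos.mul (hf L x)).add
    (hSx.sin.mul (hf (L ∘ₗ LinearMap.mulRight ℝ γ21) x))
  have expand (a : STA) (θ : ℝ) : L (a * expG21 θ) =
      Real.cos θ * L a + Real.sin θ * (L ∘ₗ LinearMap.mulRight ℝ γ21) a := by
    simp [expG21, Algebra.algebraMap_eq_smul_one, mul_add]
  have expand' (a : STA) (θ : ℝ) : L (a * (γ21 * expG21 θ)) =
      Real.cos θ * (L ∘ₗ LinearMap.mulRight ℝ γ21) a - Real.sin θ * L a := by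
    simp [expG21, Algebra.algebraMap_eq_smul_one, mul_add, γ21_mul_self, sub_eq_add_neg]
  simp only [expand, map_add, map_smul, expand', smul_eq_mul]
  refine HasDerivAt.congr_deriv h ?_
  simp only [zero_smul, add_zero]
  ring

theorem HasPDeriv.unique {μ : Fin 4} {f f₁ f₂ : (Fin 4 → ℝ) → STA} (h₁ : HasPDeriv μ f f₁)
    (h₂ : HasPDeriv μ f f₂) : f₁ = f₂ := by
  funext x
  rw [← sub_eq_zero, ← Module.forall_dual_apply_eq_zero_iff ℝ]
  intro L
  rw [map_sub, sub_eq_zero]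
  exact (h₁ L x).unique (h₂ L x)

/-- Realization of de Broglie's double solution: if `ϝ(x) = ϝ₀(x) e^{S(x)γ21}` satisfies
the free Dirac–Hestenes equation `∂ϝ γ21 - m ϝ γ⁰ = 0` and the guidance condition
`-(∂S) ϝ₀ = m ϝ₀ γ⁰`, then `ϝ₀` satisfies the massless Dirac–Hestenes equation
`∂ϝ₀ = 0`. -/
theorem statement10 (m : ℝ)
    (F₀ : (Fin 4 → ℝ) → STA) (F₀' : Fin 4 → (Fin 4 → ℝ) → STA)
    (hF₀' : ∀ μ, HasPDeriv μ F₀ (F₀' μ))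
    (S : (Fin 4 → ℝ) → ℝ) (hS : Differentiable ℝ S)
    (F : (Fin 4 → ℝ) → STA) (hF : F = fun x => F₀ x * expG21 (S x))
    (F' : Fin 4 → (Fin 4 → ℝ) → STA) (hF' : ∀ μ, HasPDeriv μ F (F' μ))
    (hDH : ∀ x, ∑ μ, γup μ * F' μ x * γ21 - m • (F x * γ 0) = 0)
    (hguide : ∀ x, -((∑ μ, pd μ S x • γup μ) * F₀ x) = m • (F₀ x * γ 0)) :
    ∀ x, ∑ μ, γup μ * F₀' μ x = 0 := by
  intro x
  have hE : Commute γ21 (expG21 (S x)) := ((Commute.refl γ21).expG21_left _).symm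
  have hF'x (μ : Fin 4) : F' μ x * γ21 =
      F₀' μ x * (expG21 (S x) * γ21) - pd μ S x • (F₀ x * expG21 (S x)) := by
    have h := (hF ▸ hF' μ).unique ((hF₀' μ).mul_expG21 hS)
    rw [h, add_mul, smul_mul_assoc, mul_assoc, mul_assoc, hE.eq, mul_assoc, γ21_mul_self]
    simp [sub_eq_add_neg]
  have hmass : m • (F x * γ 0) = -((∑ μ, pd μ S x • γup μ) * F₀ x) * expG21 (S x) := by
    rw [hguide, hF, mul_assoc, (commute_γ21_γ_zero.expG21_left _).eq, smul_mul_assoc, mul_assoc]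
  have hzero : (∑ μ, γup μ * F₀' μ x) * (expG21 (S x) * γ21) = 0 := by
    rw [← hDH x, hmass]
    simp only [mul_assoc, hF'x, mul_sub, Finset.sum_sub_distrib, Finset.sum_mul, mul_smul_comm,
      smul_mul_assoc, neg_mul]
    abel
  have hinv : expG21 (S x) * γ21 * (-(γ21 * expG21 (-S x))) = 1 := by
    rw [mul_neg, mul_assoc, ← mul_assoc γ21, γ21_mul_self, neg_one_mul, mul_neg, neg_neg,
      expG21_mul_expG21_neg]
  rw [← mul_one (∑ μ, _), ← hinv, ← mul_assoc, hzero, zero_mul]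
end
end

section
/- (Subluminal soliton-like solution of the wave equation.) Let m > 0 and ω, k ∈ ℝ with ω > 0, ω² − k² = m², and v := k/ω ∈ (0,1); set Γ := (1 − v²)^{−1/2}. Define ξ(t,x,y,z) := √(x² + y² + Γ²(z − vt)²) and F(t,x,y,z) := (sin(m·ξ(t,x,y,z)) / ξ(t,x,y,z)) · sin(ωt − kz). Then at every point (t,x,y,z) ∈ ℝ⁴ with ξ(t,x,y,z) ≠ 0, F satisfies the homogeneous wave equation: ∂²F/∂t² − ∂²F/∂x² − ∂²F/∂y² − ∂²F/∂z² = 0. -/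
noncomputable section

open Filter Topology in
/-- The second derivative of `sin (m √q) / √q * sin p` along a line on which `p` is affine. -/
lemma deriv_deriv_sinc_sqrt_mul_sin (m w c s : ℝ) (q q' p : ℝ → ℝ)
    (hq : ∀ a, HasDerivAt q (q' a) a) (hq' : HasDerivAt q' c s)
    (hp : ∀ a, HasDerivAt p w a) (hs : 0 < q s) :
    deriv (fun a => deriv (fun b =>
        Real.sin (m * Real.sqrt (q b)) / Real.sqrt (q b) * Real.sin (p b)) a) s =
      (q' s ^ 2 / 4 * (-m ^ 2 * Real.sin (m * Real.sqrt (q s)) / Real.sqrt (q s) ^ 3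
          - 3 * ((m * Real.sqrt (q s) * Real.cos (m * Real.sqrt (q s))
            - Real.sin (m * Real.sqrt (q s))) / Real.sqrt (q s) ^ 3) / Real.sqrt (q s) ^ 2)
        + c / 2 * ((m * Real.sqrt (q s) * Real.cos (m * Real.sqrt (q s))
            - Real.sin (m * Real.sqrt (q s))) / Real.sqrt (q s) ^ 3)
        - w ^ 2 * (Real.sin (m * Real.sqrt (q s)) / Real.sqrt (q s))) * Real.sin (p s)
      + (m * Real.sqrt (q s) * Real.cos (m * Real.sqrt (q s))
            - Real.sin (m * Real.sqrt (q s))) / Real.sqrt (q s) ^ 3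
          * (q' s * w) * Real.cos (p s) := by
  have hev : ∀ᶠ a in 𝓝 s, 0 < q a := (hq s).continuousAt.eventually (lt_mem_nhds hs)
  have hfirst : (fun a => deriv (fun b =>
      Real.sin (m * Real.sqrt (q b)) / Real.sqrt (q b) * Real.sin (p b)) a) =ᶠ[𝓝 s]
      fun a => (m * Real.sqrt (q a) * Real.cos (m * Real.sqrt (q a))
            - Real.sin (m * Real.sqrt (q a))) / Real.sqrt (q a) ^ 3 * (q' a / 2) * Real.sin (p a)
          + Real.sin (m * Real.sqrt (q a)) / Real.sqrt (q a) * (w * Real.cos (p a)) := by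
    filter_upwards [hev] with a ha
    have hr : 0 < Real.sqrt (q a) := Real.sqrt_pos.2 ha
    have hd := (hq a).sqrt ha.ne'
    have h := (((hd.const_mul m).sin.fun_div hd hr.ne').fun_mul (hp a).sin)
    rw [h.deriv]
    field_simp
  rw [hfirst.deriv_eq]
  have hr : 0 < Real.sqrt (q s) := Real.sqrt_pos.2 hs
  have hd := (hq s).sqrt hs.ne'
  have hmd := hd.const_mul m
  have h := (((((hmd.fun_mul hmd.cos).fun_sub hmd.sin).fun_div (hd.fun_pow 3)
    (pow_pos hr 3).ne').fun_mul (hq'.div_const 2)).fun_mul (hp s).sin).fun_add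
    ((hmd.sin.fun_div hd hr.ne').fun_mul ((hp s).cos.const_mul w))
  rw [h.deriv]
  field_simp
  ring

/-- Subluminal soliton-like solution of the wave equation: with `ω² - k² = m²`,
`v = k/ω ∈ (0,1)`, `Γ = (1-v²)^{-1/2}`, `ξ = √(x² + y² + Γ²(z - vt)²)`, the function
`F(t,x,y,z) = (sin(mξ)/ξ) sin(ωt - kz)` satisfies the homogeneous wave equation
`∂²F/∂t² - ∂²F/∂x² - ∂²F/∂y² - ∂²F/∂z² = 0` at every point where `ξ ≠ 0`. -/
theorem statement11 (m ω k : ℝ) (hm : 0 < m) (hω : 0 < ω)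
    (hdisp : ω ^ 2 - k ^ 2 = m ^ 2)
    (v : ℝ) (hv : v = k / ω) (hv0 : 0 < v) (hv1 : v < 1)
    (Γ : ℝ) (hΓ : Γ = (Real.sqrt (1 - v ^ 2))⁻¹)
    (ξ F : ℝ → ℝ → ℝ → ℝ → ℝ)
    (hξ : ξ = fun t x y z => Real.sqrt (x ^ 2 + y ^ 2 + Γ ^ 2 * (z - v * t) ^ 2))
    (hF : F = fun t x y z =>
      Real.sin (m * ξ t x y z) / ξ t x y z * Real.sin (ω * t - k * z))
    (t x y z : ℝ) (hne : ξ t x y z ≠ 0) :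
    deriv (fun s => deriv (fun s' => F s' x y z) s) t
      - deriv (fun s => deriv (fun s' => F t s' y z) s) x
      - deriv (fun s => deriv (fun s' => F t x s' z) s) y
      - deriv (fun s => deriv (fun s' => F t x y s') s) z = 0 := by
  subst hξ hF
  have hrpos : 0 < Real.sqrt (x ^ 2 + y ^ 2 + Γ ^ 2 * (z - v * t) ^ 2) :=
    lt_of_le_of_ne (Real.sqrt_nonneg _) (Ne.symm hne)
  have hq0 := Real.sqrt_pos.1 hrpos
  have hk : k = v * ω := by rw [hv]; field_simp
  have hv2 : 0 < 1 - v ^ 2 := by nlinarith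
  have hΓ2 : Γ ^ 2 * (1 - v ^ 2) = 1 := by
    rw [hΓ, inv_pow, Real.sq_sqrt hv2.le, inv_mul_cancel₀ hv2.ne']
  have hlin_t (a : ℝ) : HasDerivAt (fun a => z - v * a) (-v) a := by
    simpa using ((hasDerivAt_id a).const_mul v).const_sub z
  have hlin_z (a : ℝ) : HasDerivAt (fun a => a - v * t) 1 a := (hasDerivAt_id a).sub_const _
  have ht := deriv_deriv_sinc_sqrt_mul_sin m ω (2 * Γ ^ 2 * v ^ 2) t
    (fun a => x ^ 2 + y ^ 2 + Γ ^ 2 * (z - v * a) ^ 2) (fun a => -2 * Γ ^ 2 * v * (z - v * a))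
    (fun a => ω * a - k * z)
    (fun a => ((((hlin_t a).fun_pow 2).const_mul (Γ ^ 2)).const_add _).congr_deriv
      (by push_cast; ring))
    (((hlin_t t).const_mul _).congr_deriv (by ring))
    (fun a => (((hasDerivAt_id a).const_mul ω).sub_const _).congr_deriv (by ring)) hq0
  have hx := deriv_deriv_sinc_sqrt_mul_sin m 0 2 x
    (fun a => a ^ 2 + y ^ 2 + Γ ^ 2 * (z - v * t) ^ 2) (fun a => 2 * a)
    (fun _ => ω * t - k * z)
    (fun a => ((((hasDerivAt_id a).fun_pow 2).add_const _).add_const _).congr_deriv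
      (by simp))
    (((hasDerivAt_id x).const_mul 2).congr_deriv (by ring))
    (fun a => hasDerivAt_const a _) hq0
  have hy := deriv_deriv_sinc_sqrt_mul_sin m 0 2 y
    (fun a => x ^ 2 + a ^ 2 + Γ ^ 2 * (z - v * t) ^ 2) (fun a => 2 * a)
    (fun _ => ω * t - k * z)
    (fun a => ((((hasDerivAt_id a).fun_pow 2).const_add _).add_const _).congr_deriv
      (by simp))
    (((hasDerivAt_id y).const_mul 2).congr_deriv (by ring))
    (fun a => hasDerivAt_const a _) hq0
  have hz := deriv_deriv_sinc_sqrt_mul_sin m (-k) (2 * Γ ^ 2) z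
    (fun a => x ^ 2 + y ^ 2 + Γ ^ 2 * (a - v * t) ^ 2) (fun a => 2 * Γ ^ 2 * (a - v * t))
    (fun a => ω * t - k * a)
    (fun a => ((((hlin_z a).fun_pow 2).const_mul (Γ ^ 2)).const_add _).congr_deriv
      (by push_cast; ring))
    (((hlin_z z).const_mul _).congr_deriv (by ring))
    (fun a => (((hasDerivAt_id a).const_mul k).const_sub _).congr_deriv (by ring)) hq0
  have hrsq := Real.sq_sqrt hq0.le
  beta_reduce at ht hx hy hz ⊢
  rw [ht, hx, hy, hz]
  generalize Real.sqrt (x ^ 2 + y ^ 2 + Γ ^ 2 * (z - v * t) ^ 2) = r at *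
  generalize Real.sin (ω * t - k * z) = P
  generalize Real.cos (ω * t - k * z) = Q
  generalize hA : (m * r * Real.cos (m * r) - Real.sin (m * r)) / r ^ 3 = A
  generalize Real.sin (m * r) = S
  have hB : r ^ 2 * (-m ^ 2 * S / r ^ 3 - 3 * A / r ^ 2) = -m ^ 2 * (S / r) - 3 * A := by
    field_simp
  generalize -m ^ 2 * S / r ^ 3 - 3 * A / r ^ 2 = B at *
  generalize S / r = U at *
  linear_combination (-P) * hB + (P * B) * hrsq - P * U * hdisp
    - 2 * A * Q * Γ ^ 2 * (z - v * t) * (-hk)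
    + (-(P * B * Γ ^ 2 * (z - v * t) ^ 2) - P * A) * hΓ2
end
end
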